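/- Let d ≥ 3 and let t ∈ 𝒟'(ℝ^d) be any distribution whose restriction to ℝ^d ∖ {0} equals the function |x|^{-d}, and which satisfies xᵘ·t = xᵘ·|x|^{-d} as distributions on ℝ^d for each coordinate function xᵘ (note the right-hand side is locally integrable). Then Σᵤ ∂ᵤ(xᵘ t) = |S^{d−1}|·δ₀ in 𝒟'(ℝ^d). -/

import Mathlib

open scoped BigOperators

open MeasureTheory Set Metric in
/-- `x_u |x|^{-d} g` is integrable for continuous compactly supported `g`. -/
theorem aux_integrable (d : ℕ) (hd : 3 ≤ d) (u : Fin d)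
    (g : EuclideanSpace ℝ (Fin d) → ℝ) (hg : Continuous g) (hgc : HasCompactSupport g) :
    Integrable (fun x : EuclideanSpace ℝ (Fin d) => x u * ‖x‖ ^ (-(d : ℝ)) * g x) := by
  have : Nonempty (Fin d) := ⟨u⟩
  have : Nontrivial (EuclideanSpace ℝ (Fin d)) := inferInstance
  obtain ⟨C, hC⟩ := hg.bounded_above_of_compact_support hgc
  obtain ⟨R, hR⟩ := hgc.isCompact.isBounded.subset_ball 0
  have h1 : IntegrableOn (fun x : EuclideanSpace ℝ (Fin d) => C * (‖x‖ * ‖x‖ ^ (-(d : ℝ))))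
      (ball 0 R) := by
    apply Integrable.const_mul
    have := (integrableOn_fun_norm_addHaar (E := EuclideanSpace ℝ (Fin d)) volume
      (f := fun y => y * y ^ (-(d:ℝ))) (r := R)).2 ?_
    · exact this
    · have h : IntegrableOn (fun _ : ℝ => (1 : ℝ)) (Ioo 0 R) := by simp
      refine h.congr_fun ?_ measurableSet_Ioo
      intro y hy
      have hy0 : 0 < y := hy.1
      simp only [finrank_euclideanSpace, Fintype.card_fin, smul_eq_mul]
      rw [Real.rpow_neg hy0.le, Real.rpow_natCast, ← mul_assoc, ← pow_succ,
        Nat.sub_add_cancel (by omega), mul_inv_cancel₀ (by positivity)]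
  have h2 : IntegrableOn (fun x : EuclideanSpace ℝ (Fin d) => x u * ‖x‖ ^ (-(d : ℝ)) * g x)
      (ball 0 R) := by
    refine Integrable.mono' h1 ?_ (Filter.Eventually.of_forall fun x => ?_)
    · apply Measurable.aestronglyMeasurable
      have := hg.measurable
      fun_prop
    · rw [norm_mul, norm_mul, mul_comm C]
      have h3 : ‖x u‖ ≤ ‖x‖ := PiLp.norm_apply_le x u
      have h4 : ‖‖x‖ ^ (-(d : ℝ))‖ = ‖x‖ ^ (-(d : ℝ)) := Real.norm_of_nonneg (by positivity)
      rw [h4]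
      gcongr
      exact hC x
  rwa [integrableOn_iff_integrable_of_support_subset] at h2
  intro x hx
  apply hR
  apply subset_tsupport
  intro h
  simp [h] at hx

open MeasureTheory Set Metric in
theorem aux_integral (d : ℕ) (hd : 3 ≤ d)
    (f : EuclideanSpace ℝ (Fin d) → ℝ)
    (hf : ContDiff ℝ 1 f) (hfc : HasCompactSupport f)
    (hint : Integrable (fun x : EuclideanSpace ℝ (Fin d) => ‖x‖ ^ (-(d : ℝ)) * fderiv ℝ f x x)) :
    ∫ x : EuclideanSpace ℝ (Fin d), ‖x‖ ^ (-(d : ℝ)) * fderiv ℝ f x x =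
      -((2 * Real.pi ^ ((d : ℝ) / 2) / Real.Gamma ((d : ℝ) / 2)) * f 0) := by
  have : Nonempty (Fin d) := ⟨⟨0, by omega⟩⟩
  have : Nontrivial (EuclideanSpace ℝ (Fin d)) := inferInstance
  set G : (EuclideanSpace ℝ (Fin d)) → ℝ := fun x => ‖x‖ ^ (-(d : ℝ)) * fderiv ℝ f x x with hG
  let H : sphere (0 : (EuclideanSpace ℝ (Fin d))) 1 × Ioi (0 : ℝ) → ℝ := fun p => G (p.2.1 • p.1.1)
  have hHG : ∀ x : ({0}ᶜ : Set (EuclideanSpace ℝ (Fin d))), H (homeomorphUnitSphereProd (EuclideanSpace ℝ (Fin d)) x) = G x := by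
    intro x
    have hx : ‖(x : (EuclideanSpace ℝ (Fin d)))‖ ≠ 0 := norm_ne_zero_iff.2 x.2
    simp [H, smul_smul, hx]
  have mp := (volume : Measure (EuclideanSpace ℝ (Fin d))).measurePreserving_homeomorphUnitSphereProd
  have hdim : Module.finrank ℝ (EuclideanSpace ℝ (Fin d)) = d := by simp
  rw [hdim] at mp
  have hHint : Integrable H ((volume : Measure (EuclideanSpace ℝ (Fin d))).toSphere.prod (.volumeIoiPow (d - 1))) := by
    rw [← mp.integrable_comp_emb (Homeomorph.measurableEmbedding _)]
    have : H ∘ homeomorphUnitSphereProd (EuclideanSpace ℝ (Fin d)) = G ∘ Subtype.val := funext hHG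
    rw [this, ← integrableOn_iff_comap_subtypeVal (measurableSet_singleton _).compl]
    exact hint.integrableOn
  have inner : ∀ w : sphere (0 : (EuclideanSpace ℝ (Fin d))) 1,
      ∫ r : Ioi (0 : ℝ), H (w, r) ∂(.volumeIoiPow (d - 1)) = - f 0 := by
    intro w
    have hw : ‖(w : (EuclideanSpace ℝ (Fin d)))‖ = 1 := by simpa using w.2
    have hw0 : (w : (EuclideanSpace ℝ (Fin d))) ≠ 0 := by intro h; simp [h] at hw
    have hcg : ContDiff ℝ 1 (fun r : ℝ => f (r • (w : (EuclideanSpace ℝ (Fin d))))) := by fun_prop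
    have hsg : HasCompactSupport (fun r : ℝ => f (r • (w : (EuclideanSpace ℝ (Fin d))))) := by
      obtain ⟨R, hR⟩ := hfc.isCompact.isBounded.subset_closedBall 0
      refine HasCompactSupport.intro (isCompact_closedBall (0 : ℝ) R) fun r hr => ?_
      by_contra h
      have := hR (subset_tsupport _ h)
      simp [norm_smul, hw] at this hr
      linarith
    have hd1 := hsg.integral_Ioi_deriv_eq hcg 0
    rw [zero_smul] at hd1
    rw [← hd1]
    simp only [Measure.volumeIoiPow, ENNReal.ofReal]
    rw [integral_withDensity_eq_integral_smul,
        integral_subtype_comap measurableSet_Ioi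
          fun a : ℝ ↦ Real.toNNReal (a ^ (d - 1)) • G (a • (w : (EuclideanSpace ℝ (Fin d)))),
        setIntegral_congr_fun measurableSet_Ioi fun x hx ↦ ?_]
    · have hx0 : 0 < x := hx
      have hder : HasDerivAt (fun r : ℝ => f (r • (w : (EuclideanSpace ℝ (Fin d))))) (fderiv ℝ f (x • (w : (EuclideanSpace ℝ (Fin d)))) w) x := by
        have h1 := (hf.differentiable one_ne_zero (x • (w : (EuclideanSpace ℝ (Fin d))))).hasFDerivAt
        have h2 : HasDerivAt (fun r : ℝ => r • (w : (EuclideanSpace ℝ (Fin d)))) (w : (EuclideanSpace ℝ (Fin d))) x := by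
          simpa using (hasDerivAt_id x).smul_const (w : (EuclideanSpace ℝ (Fin d)))
        exact h1.comp_hasDerivAt x h2
      simp only [hder.deriv, NNReal.smul_def, Real.coe_toNNReal _ (pow_nonneg hx0.le _), hG,
        norm_smul, hw, map_smul, smul_eq_mul, mul_one, Real.norm_of_nonneg hx0.le]
      rw [Real.rpow_neg hx0.le, Real.rpow_natCast]
      have : x ^ d = x ^ (d - 1) * x := by rw [← pow_succ, Nat.sub_add_cancel (by omega)]
      rw [this]
      field_simp
    · exact (measurable_subtype_coe.pow_const _).real_toNNReal
  have hvol : (volume : Measure (EuclideanSpace ℝ (Fin d))).toSphere.real univ =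
      2 * Real.pi ^ ((d : ℝ) / 2) / Real.Gamma ((d : ℝ) / 2) := by
    have hdpos : (0 : ℝ) < (d : ℝ) / 2 := by
      have : (0 : ℝ) < d := by exact_mod_cast (by omega : 0 < d)
      positivity
    have hGpos := Real.Gamma_pos_of_pos hdpos
    rw [Measure.toSphere_real_apply_univ, measureReal_def, EuclideanSpace.volume_ball, hdim]
    simp only [Fintype.card_fin, ENNReal.ofReal_one, one_pow, one_mul]
    rw [Real.Gamma_add_one hdpos.ne', ENNReal.toReal_ofReal (by positivity),
      Real.sqrt_eq_rpow, ← Real.rpow_natCast, ← Real.rpow_mul Real.pi_pos.le]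
    rw [show (1 / 2 : ℝ) * d = d / 2 by ring]
    have : (d : ℝ) ≠ 0 := by intro h; simp [h] at hdpos
    field_simp
  calc ∫ x, G x = ∫ x : ({(0)}ᶜ : Set (EuclideanSpace ℝ (Fin d))), G x.1 ∂(Measure.comap Subtype.val volume) := by
        rw [integral_subtype_comap (measurableSet_singleton _).compl G,
          restrict_compl_singleton]
    _ = ∫ p, H p ∂((volume : Measure (EuclideanSpace ℝ (Fin d))).toSphere.prod (.volumeIoiPow (d - 1))) := by
        rw [← mp.integral_comp (Homeomorph.measurableEmbedding _)]
        simp only [hHG]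
    _ = _ := by
        rw [integral_prod _ hHint]
        simp only [inner, integral_const, hvol, smul_eq_mul, mul_neg]

/-- Let `t` be any extension of the homogeneous function
`|x|^{-d}` (`d ≥ 3`) to a distribution on `ℝ^d` such that moreover
`xᵘ·t = xᵘ·|x|^{-d}` (the right hand side being locally integrable).  Then
`Σᵤ ∂ᵤ(xᵘ t) = |S^{d−1}| δ₀`, i.e. for every test function `f`,
`−Σᵤ t(x ↦ xᵘ ∂ᵤf(x)) = |S^{d−1}| f(0)` with `|S^{d−1}| = 2π^{d/2}/Γ(d/2)`. -/
theorem scaling_violation_of_extension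
    (d : ℕ) (hd : 3 ≤ d)
    (t : (EuclideanSpace ℝ (Fin d) → ℝ) → ℝ)
    (ht_lin : ∀ (a : ℝ) (f g : EuclideanSpace ℝ (Fin d) → ℝ),
      t (a • f + g) = a * t f + t g)
    (h_restr : ∀ f : EuclideanSpace ℝ (Fin d) → ℝ,
      ContDiff ℝ (⊤ : ℕ∞) f → HasCompactSupport f → (0 : EuclideanSpace ℝ (Fin d)) ∉ tsupport f →
      t f = ∫ x : EuclideanSpace ℝ (Fin d), ‖x‖ ^ (-(d : ℝ)) * f x)
    (h_mul : ∀ (u : Fin d) (f : EuclideanSpace ℝ (Fin d) → ℝ),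
      ContDiff ℝ (⊤ : ℕ∞) f → HasCompactSupport f →
      t (fun x => x u * f x) =
        ∫ x : EuclideanSpace ℝ (Fin d), x u * ‖x‖ ^ (-(d : ℝ)) * f x)
    (f : EuclideanSpace ℝ (Fin d) → ℝ)
    (hf : ContDiff ℝ (⊤ : ℕ∞) f) (hfc : HasCompactSupport f) :
    -∑ u : Fin d, t (fun x => x u * fderiv ℝ f x (EuclideanSpace.single u 1)) =
      (2 * Real.pi ^ ((d : ℝ) / 2) / Real.Gamma ((d : ℝ) / 2)) * f 0 := by
  have hf1 : ContDiff ℝ 1 f := hf.of_le (by exact_mod_cast le_top)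
  have hgs : ∀ u : Fin d, ContDiff ℝ (⊤ : ℕ∞)
      (fun x => fderiv ℝ f x (EuclideanSpace.single u 1)) := fun u =>
    (hf.fderiv_right (m := (⊤ : ℕ∞)) (by simp)).clm_apply contDiff_const
  have hgc : ∀ u : Fin d, HasCompactSupport
      (fun x => fderiv ℝ f x (EuclideanSpace.single u 1)) := fun u =>
    hfc.fderiv_apply ℝ _
  have hI := fun u => aux_integrable d hd u _ (hgs u).continuous (hgc u)
  have hsum : ∀ x : EuclideanSpace ℝ (Fin d),
      ∑ u, x u * ‖x‖ ^ (-(d : ℝ)) * fderiv ℝ f x (EuclideanSpace.single u 1) =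
        ‖x‖ ^ (-(d : ℝ)) * fderiv ℝ f x x := by
    intro x
    have hx : x = ∑ u, x u • EuclideanSpace.single u (1 : ℝ) := by
      ext i
      simp [Pi.single_apply]
    conv_rhs => rw [hx, map_sum, ← hx]
    rw [Finset.mul_sum]
    refine Finset.sum_congr rfl fun u _ => ?_
    rw [map_smul, smul_eq_mul]
    ring
  have hint := MeasureTheory.integrable_finsetSum Finset.univ fun u _ => hI u
  simp only [hsum] at hint
  rw [Finset.sum_congr rfl fun u _ => h_mul u _ (hgs u) (hgc u),
    ← MeasureTheory.integral_finsetSum _ fun u _ => hI u]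
  simp only [hsum]
  rw [aux_integral d hd f hf1 hfc hint, neg_neg]
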